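/- arXiv:2604.22630 — 2 statements merged into one kernel-verified Lean document; each statement's English description precedes it below -/
import Mathlib

section
/- For every graph F with at least one edge, every edge e ∈ E(F), and every ε > 0, there exists n₀ such that for all n ≥ n₀ we have M_F(n) ≤ ((χ(F−e)−2)/(χ(F−e)−1) + ε)·C(n,2), where χ denotes the chromatic number. -/
open Finset Filter

/-- Adding `e` to the graph `H` creates a new copy of `F`, i.e. a copy using `e`. -/
def GCreates {α β : Type*} (F : SimpleGraph α) (H : SimpleGraph β) (e : Sym2 β) : Prop :=
  ∃ f : α ↪ β, (∀ a b, F.Adj a b → (H ⊔ SimpleGraph.fromEdgeSet {e}).Adj (f a) (f b)) ∧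
    ∃ a b, F.Adj a b ∧ s(f a, f b) = e

/-- One step of the `F`-bootstrap percolation process for graphs. -/
def gBootStep {α β : Type*} (F : SimpleGraph α) (H : SimpleGraph β) : SimpleGraph β :=
  H ⊔ SimpleGraph.fromEdgeSet {e | GCreates F H e}

/-- The `F`-bootstrap percolation process starting with `H0`. -/
def gProcSeq {α β : Type*} (F : SimpleGraph α) (H0 : SimpleGraph β) : ℕ → SimpleGraph β
  | 0 => H0
  | i + 1 => gBootStep F (gProcSeq F H0 i)

/-- The running time `τ_F(H0)` of the `F`-process starting with `H0`. -/
noncomputable def gRunTime {α β : Type*} (F : SimpleGraph α) (H0 : SimpleGraph β) : ℕ :=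
  sInf {i | gProcSeq F H0 i = gProcSeq F H0 (i + 1)}

/-- `M_F(n)`: the maximum running time over all starting graphs on `n` vertices. -/
noncomputable def gMaxRunTime {α : Type*} (F : SimpleGraph α) (n : ℕ) : ℕ :=
  sSup {t | ∃ H0 : SimpleGraph (Fin n), t = gRunTime F H0}

/-- `H` contains a copy of `F` (as a subgraph). -/
def GContains {α β : Type*} (F : SimpleGraph α) (H : SimpleGraph β) : Prop :=
  ∃ f : α ↪ β, ∀ a b, F.Adj a b → H.Adj (f a) (f b)

/-- The Turán extremal number `ex(n, F)` for graphs. -/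
noncomputable def gExNum {α : Type*} (F : SimpleGraph α) (n : ℕ) : ℕ :=
  sSup {m | ∃ H : SimpleGraph (Fin n), ¬ GContains F H ∧ m = H.edgeSet.ncard}

/-- Edge version of the Erdős-Stone theorem, from the minimum degree version. -/
theorem aux_erdos_stone (r t : ℕ) (hr : 1 ≤ r) (ε : ℝ) (hε : 0 < ε) :
    ∃ n₀ : ℕ, ∀ n : ℕ, n₀ ≤ n →
      (SimpleGraph.extremalNumber n (SimpleGraph.completeEquipartiteGraph (r + 1) t) : ℝ) ≤
        (1 - 1 / (r : ℝ) + ε) * (n.choose 2 : ℝ) := by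
  classical
  have hc : (0 : ℝ) ≤ 1 - 1 / (r : ℝ) := by
    have : (1 : ℝ) ≤ r := by exact_mod_cast hr
    have := (div_le_one (by linarith : (0 : ℝ) < r)).2 this
    linarith
  set c : ℝ := 1 - 1 / (r : ℝ) with hcdef
  set K := SimpleGraph.completeEquipartiteGraph (r + 1) t with hK
  obtain ⟨N, hN⟩ := eventually_atTop.1
    (SimpleGraph.eventually_completeEquipartiteGraph_isContained_of_minDegree
      (half_pos hε) r t)
  have key : ∀ n : ℕ, N ≤ n → (SimpleGraph.extremalNumber n K : ℝ) ≤
      SimpleGraph.extremalNumber N K + (c + ε / 2) * ((n + 1).choose 2 : ℝ) := by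
    intro n hn
    induction n, hn using Nat.le_induction with
    | base =>
      have : 0 ≤ (c + ε / 2) * ((N + 1).choose 2 : ℝ) := by positivity
      linarith
    | succ n hn ih =>
      have h0 : (0 : ℝ) ≤ SimpleGraph.extremalNumber N K +
          (c + ε / 2) * ((n + 1 + 1).choose 2 : ℝ) := by positivity
      have h1 := SimpleGraph.extremalNumber_le_iff_of_nonneg (V := Fin (n + 1)) K h0
      rw [Fintype.card_fin] at h1
      rw [h1]
      intro G _ hG
      have hlt : (G.minDegree : ℝ) < (c + ε / 2) * ((n + 1 : ℕ) : ℝ) := by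
        by_contra hcon
        exact hG (hN (n + 1) (by omega) (not_lt.1 hcon))
      obtain ⟨v, hv⟩ := G.exists_minimal_degree_vertex
      have h2 := SimpleGraph.card_edgeFinset_deleteIncidenceSet_le_extremalNumber hG v
      rw [SimpleGraph.card_edgeFinset_deleteIncidenceSet, Fintype.card_fin] at h2
      have h3 : #G.edgeFinset ≤ SimpleGraph.extremalNumber n K + G.degree v := by
        simp only [Nat.add_sub_cancel] at h2
        omega
      have h4 : (#G.edgeFinset : ℝ) ≤ SimpleGraph.extremalNumber n K + G.degree v := by
        exact_mod_cast h3
      have h5 : ((n + 1 + 1).choose 2 : ℝ) = ((n + 1 : ℕ) : ℝ) + ((n + 1).choose 2 : ℝ) := by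
        rw [Nat.choose_succ_succ' (n + 1) 1]; push_cast; simp
      rw [h5]
      rw [hv] at hlt
      nlinarith
  set E : ℝ := (SimpleGraph.extremalNumber N K : ℝ) with hE
  have hE0 : 0 ≤ E := by positivity
  refine ⟨max (max N 1) (⌈1 + 4 / ε * (E + c + ε / 2)⌉₊), fun n hn => ?_⟩
  have hnN : N ≤ n := by omega
  have hn1 : 1 ≤ n := by omega
  have hn2 : 1 + 4 / ε * (E + c + ε / 2) ≤ n :=
    (Nat.le_ceil _).trans (by exact_mod_cast (le_max_right _ _).trans hn)
  refine (key n hnN).trans ?_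
  have hn1' : (1 : ℝ) ≤ n := by exact_mod_cast hn1
  have h5 : ((n + 1).choose 2 : ℝ) = n + (n.choose 2 : ℝ) := by
    rw [Nat.choose_succ_succ' n 1]; push_cast; simp
  rw [h5, Nat.cast_choose_two]
  have h6 : 4 * (E + c + ε / 2) ≤ ε * (n - 1) := by
    have : ε * (4 / ε * (E + c + ε / 2)) ≤ ε * ((n : ℝ) - 1) :=
      mul_le_mul_of_nonneg_left (by linarith) hε.le
    have h7 : ε * (4 / ε * (E + c + ε / 2)) = 4 * (E + c + ε / 2) := by field_simp
    linarith
  have h8 := mul_le_mul_of_nonneg_left h6 (by linarith : (0 : ℝ) ≤ n)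
  nlinarith

theorem aux_le_step {α β : Type*} (F : SimpleGraph α) (H : SimpleGraph β) :
    H ≤ gBootStep F H := le_sup_left

theorem aux_mono {α β : Type*} (F : SimpleGraph α) (H : SimpleGraph β) :
    Monotone (gProcSeq F H) :=
  monotone_nat_of_le_succ fun i => aux_le_step F (gProcSeq F H i)

theorem aux_step_adj {α β : Type*} {F : SimpleGraph α} {H : SimpleGraph β} {x y : β}
    (hxy : x ≠ y) (h : GCreates F H s(x, y)) : (gBootStep F H).Adj x y := by
  right
  exact ⟨h, hxy⟩

/-- The key embedding lemma. -/
theorem aux_key {α β : Type*} [Fintype α] (F : SimpleGraph α) (u v : α) (huv : F.Adj u v)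
    (r t : ℕ) (c : α → Fin r)
    (hc : ∀ a b, F.Adj a b → s(a, b) ≠ s(u, v) → c a ≠ c b)
    (p q : α) (hpq : F.Adj p q) (hne : s(p, q) ≠ s(u, v))
    (A : SimpleGraph β) (K : Fin r × Fin t → β) (hK : Function.Injective K)
    (W : Finset β) (ht : #W + Fintype.card α ≤ t)
    (hA : ∀ x y, x.1 ≠ y.1 → K x ∉ W → A.Adj (K x) (K y))
    (x y : Fin r × Fin t) (hxy : x.1 ≠ y.1) (hxW : K x ∈ W) (hyW : K y ∈ W) :
    (gBootStep F (gBootStep F A)).Adj (K x) (K y) := by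
  classical
  -- generic indices
  obtain ⟨γ, hγ, hγW⟩ : ∃ γ : α → Fin t, Function.Injective γ ∧ ∀ a i, K (i, γ a) ∉ W := by
    set B : Finset (Fin t) := univ.filter fun j => ∃ i, K (i, j) ∈ W with hB
    have hBc : #B ≤ #W := by
      have hB' : ∀ j ∈ B, ∃ i, K (i, j) ∈ W := fun j hj => (Finset.mem_filter.1 hj).2
      have : Nonempty (Fin r) := ⟨x.1⟩
      choose! g hg using hB'
      refine Finset.card_le_card_of_injOn (fun j => K (g j, j)) (fun j hj => hg j hj) ?_
      intro j _ j' _ h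
      exact (Prod.ext_iff.1 (hK h)).2
    have hcard : Fintype.card α ≤ Fintype.card {j // j ∈ Bᶜ} := by
      rw [Fintype.card_coe, Finset.card_compl, Fintype.card_fin]
      omega
    obtain ⟨φ⟩ := Function.Embedding.nonempty_of_card_le hcard
    refine ⟨fun a => (φ a).1, fun a b h => φ.injective (Subtype.ext h), fun a i hi => ?_⟩
    have := (φ a).2
    simp only [Finset.mem_compl, hB, Finset.mem_filter, Finset.mem_univ, true_and] at this
    exact this ⟨i, hi⟩
  -- permuted coloring
  obtain ⟨d, hdp, hdq, hd⟩ : ∃ d : α → Fin r, d p = x.1 ∧ d q = y.1 ∧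
      ∀ a b, F.Adj a b → s(a, b) ≠ s(u, v) → d a ≠ d b := by
    have hcpq := hc p q hpq hne
    set σ₁ := Equiv.swap (c p) x.1
    set σ₂ := Equiv.swap (σ₁ (c q)) y.1
    have h1 : σ₁ (c p) = x.1 := Equiv.swap_apply_left _ _
    refine ⟨fun a => σ₂ (σ₁ (c a)), ?_, Equiv.swap_apply_left _ _, fun a b h h' h'' =>
      hc a b h h' (σ₁.injective (σ₂.injective h''))⟩
    simp only [h1]
    apply Equiv.swap_apply_of_ne_of_ne
    · rw [← h1]; exact fun h => hcpq (σ₁.injective h)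
    · exact hxy
  have hpq' : p ≠ q := hpq.ne
  -- positions
  set pos : Set α → α → Fin r × Fin t := fun S a =>
    if a = p ∧ a ∈ S then x else if a = q ∧ a ∈ S then y else (d a, γ a) with hpos
  have pos1 : ∀ S a, (pos S a).1 = d a := by
    intro S a
    simp only [hpos]
    split_ifs with h1 h2
    · rw [h1.1, hdp]
    · rw [h2.1, hdq]
    · rfl
  have posgen : ∀ S a, ¬ (a ∈ S ∧ (a = p ∨ a = q)) → K (pos S a) ∉ W := by
    intro S a h
    simp only [hpos]
    rw [if_neg (by tauto), if_neg (by tauto)]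
    exact hγW a _
  have posinj : ∀ S, Function.Injective (fun a => K (pos S a)) := by
    intro S a b hab
    have hab : pos S a = pos S b := hK hab
    have hg : ∀ z, (d z, γ z) ≠ x ∧ (d z, γ z) ≠ y := fun z =>
      ⟨fun h => hγW z (d z) (h ▸ hxW), fun h => hγW z (d z) (h ▸ hyW)⟩
    have hxy' : x ≠ y := fun h => hxy (by rw [h])
    simp only [hpos] at hab
    split_ifs at hab with h1 h2 h3 h4 h5 h6 h7 h8
    all_goals first
      | exact hγ (Prod.ext_iff.1 hab).2
      | (exfalso; first | exact hxy' hab | exact hxy' hab.symm | exact (hg _).1 hab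
                        | exact (hg _).1 hab.symm | exact (hg _).2 hab | exact (hg _).2 hab.symm)
      | (obtain ⟨rfl, _⟩ := h1; simp_all)
      | simp_all
  have adjA : ∀ S a b, F.Adj a b → s(a, b) ≠ s(u, v) →
      ¬ ((a ∈ S ∧ (a = p ∨ a = q)) ∧ (b ∈ S ∧ (b = p ∨ b = q))) →
      A.Adj (K (pos S a)) (K (pos S b)) := by
    intro S a b hab hne' h
    have hcol := hd a b hab hne'
    by_cases ha : a ∈ S ∧ (a = p ∨ a = q)
    · have hb := fun hb => h ⟨ha, hb⟩
      exact (hA _ _ (by rw [pos1, pos1]; exact hcol.symm) (posgen S b hb)).symm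
    · exact hA _ _ (by rw [pos1, pos1]; exact hcol) (posgen S a ha)
  have posp : pos Set.univ p = x := by simp [hpos]
  have posq : pos Set.univ q = y := by simp [hpos, hpq'.symm]
  -- the pair uv
  have huvS : (gBootStep F A).Adj (K (pos Set.univ u)) (K (pos Set.univ v)) := by
    apply aux_step_adj (fun h => huv.ne (posinj _ h))
    have hu : pos {u, v} u = pos Set.univ u := by simp [hpos]
    have hv : pos {u, v} v = pos Set.univ v := by simp [hpos]
    refine ⟨⟨_, posinj {u, v}⟩, fun a b hab => ?_, u, v, huv, ?_⟩
    · by_cases h : s(a, b) = s(u, v)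
      · right
        refine ⟨?_, fun h' => hab.ne (posinj _ h')⟩
        simp only [Function.Embedding.coeFn_mk]
        rw [← hu, ← hv]
        rcases Sym2.eq_iff.1 h with ⟨rfl, rfl⟩ | ⟨rfl, rfl⟩
        · rfl
        · exact Sym2.eq_swap
      · left
        apply adjA _ _ _ hab h
        rintro ⟨⟨ha, _⟩, ⟨hb, _⟩⟩
        have := hab.ne
        simp only [Set.mem_insert_iff, Set.mem_singleton_iff] at ha hb
        apply h
        rcases ha with rfl | rfl <;> rcases hb with rfl | rfl
        · exact absurd rfl this
        · rfl
        · exact Sym2.eq_swap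
        · exact absurd rfl this
    · simp only [Function.Embedding.coeFn_mk]
      rw [hu, hv]
  apply aux_step_adj (fun h => hxy (by rw [hK h]))
  refine ⟨⟨_, posinj Set.univ⟩, fun a b hab => ?_, p, q, hpq, ?_⟩
  · simp only [Function.Embedding.coeFn_mk]
    by_cases h : s(a, b) = s(u, v)
    · left
      rcases Sym2.eq_iff.1 h with ⟨rfl, rfl⟩ | ⟨rfl, rfl⟩
      · exact huvS
      · exact huvS.symm
    · by_cases h' : s(a, b) = s(p, q)
      · right
        refine ⟨?_, fun h' => hab.ne (posinj _ h')⟩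
        rcases Sym2.eq_iff.1 h' with ⟨rfl, rfl⟩ | ⟨rfl, rfl⟩
        · simp only [posp, posq]; rfl
        · simp only [posp, posq]; exact Sym2.eq_swap
      · left
        apply aux_le_step
        apply adjA _ _ _ hab h
        rintro ⟨⟨_, ha⟩, ⟨_, hb⟩⟩
        have := hab.ne
        apply h'
        rcases ha with rfl | rfl <;> rcases hb with rfl | rfl
        · exact absurd rfl this
        · rfl
        · exact Sym2.eq_swap
        · exact absurd rfl this
  · simp only [Function.Embedding.coeFn_mk, posp, posq]

/-- The running time is at most the extremal number of a complete equipartite graph. -/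
theorem aux_runtime {α : Type*} [Fintype α] (F : SimpleGraph α) (u v : α) (huv : F.Adj u v)
    (r : ℕ) (c : α → Fin r)
    (hc : ∀ a b, F.Adj a b → s(a, b) ≠ s(u, v) → c a ≠ c b)
    (p q : α) (hpq : F.Adj p q) (hne : s(p, q) ≠ s(u, v)) (n : ℕ) (H : SimpleGraph (Fin n)) :
    gRunTime F H ≤ SimpleGraph.extremalNumber n
      (SimpleGraph.completeEquipartiteGraph r (6 + Fintype.card α)) := by
  classical
  by_contra hcon
  push Not at hcon
  set τ := gRunTime F H with hτ
  have hstep : ∀ i, i < τ → ∃ e : Sym2 (Fin n),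
      e ∈ (gProcSeq F H (i + 1)).edgeSet ∧ e ∉ (gProcSeq F H i).edgeSet := by
    intro i hi
    by_contra hno
    push Not at hno
    have hle : gProcSeq F H (i + 1) ≤ gProcSeq F H i := SimpleGraph.edgeSet_subset_edgeSet.1 hno
    have : i ∈ {i | gProcSeq F H i = gProcSeq F H (i + 1)} :=
      le_antisymm (aux_mono F H (Nat.le_succ i)) hle
    exact absurd (Nat.sInf_le this) (not_le.2 hi)
  have : Nonempty (Sym2 (Fin n)) := ⟨(hstep 0 (by omega)).choose⟩
  choose! ed hed hed' using hstep
  have hord : ∀ i j, i < τ → j < τ → i < j → ed i ≠ ed j := by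
    intro i j hi hj hij h
    apply hed' j hj
    rw [← h]
    exact SimpleGraph.edgeSet_mono (aux_mono F H (Nat.succ_le_of_lt hij)) (hed i hi)
  have hinj : Set.InjOn ed (Finset.range τ : Set ℕ) := by
    intro i hi j hj h
    simp only [Finset.coe_range, Set.mem_Iio] at hi hj
    rcases lt_trichotomy i j with h' | h' | h'
    · exact absurd h (hord i j hi hj h')
    · exact h'
    · exact absurd h.symm (hord j i hj hi h')
  set S : Finset (Sym2 (Fin n)) := (Finset.range τ).image ed with hS
  have hScard : #S = τ := by rw [hS, Finset.card_image_of_injOn hinj, Finset.card_range]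
  set G : SimpleGraph (Fin n) := SimpleGraph.fromEdgeSet (S : Set (Sym2 (Fin n))) with hG
  have hGe : G.edgeFinset = S := by
    ext e
    rw [SimpleGraph.mem_edgeFinset, hG, SimpleGraph.edgeSet_fromEdgeSet]
    simp only [Set.mem_sdiff, Finset.mem_coe]
    refine ⟨fun h => h.1, fun h => ⟨h, ?_⟩⟩
    obtain ⟨i, hi, rfl⟩ := Finset.mem_image.1 h
    exact SimpleGraph.not_isDiag_of_mem_edgeSet _ (hed i (Finset.mem_range.1 hi))
  have hcont : (SimpleGraph.completeEquipartiteGraph r (6 + Fintype.card α)).IsContained G := by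
    apply SimpleGraph.IsContained.of_extremalNumber_lt_card_edgeFinset
    rw [Fintype.card_fin]
    refine lt_of_lt_of_eq (hcon.trans_eq (hScard.symm.trans (congrArg Finset.card hGe.symm))) ?_
    congr!
  obtain ⟨κ⟩ := hcont
  have hKadj : ∀ x y : Fin r × Fin (6 + Fintype.card α), x.1 ≠ y.1 →
      ∃ i, i < τ ∧ ed i = s(κ x, κ y) := by
    intro x y hxy
    have h1 : G.Adj (κ x) (κ y) := κ.toHom.map_adj hxy
    have h2 : s(κ x, κ y) ∈ S := h1.1
    obtain ⟨i, hi, h⟩ := Finset.mem_image.1 h2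
    exact ⟨i, Finset.mem_range.1 hi, h⟩
  -- the last time
  set I : Finset ℕ := (Finset.range τ).filter fun i =>
    ∃ x y : Fin r × Fin (6 + Fintype.card α), x.1 ≠ y.1 ∧ ed i = s(κ x, κ y) with hI
  have hIne : I.Nonempty := by
    have h0 : 0 < 6 + Fintype.card α := by omega
    obtain ⟨i, hi, h⟩ := hKadj (c p, ⟨0, h0⟩) (c q, ⟨0, h0⟩) (hc p q hpq hne)
    exact ⟨i, Finset.mem_filter.2 ⟨Finset.mem_range.2 hi, _, _, hc p q hpq hne, h⟩⟩
  obtain ⟨T, hTI, hTmax⟩ := I.exists_max_image id hIne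
  obtain ⟨hTτ, x, y, hxy, hTxy⟩ := Finset.mem_filter.1 hTI
  rw [Finset.mem_range] at hTτ
  set W : Finset (Fin n) := (ed T).toFinset ∪ ((ed (T - 1)).toFinset ∪ (ed (T - 2)).toFinset)
    with hW
  have hWc : #W ≤ 6 := by
    have h2 : ∀ e : Sym2 (Fin n), #e.toFinset ≤ 2 := by
      intro e
      rw [Sym2.card_toFinset]; split_ifs <;> omega
    have a1 := Finset.card_union_le (ed T).toFinset
      ((ed (T - 1)).toFinset ∪ (ed (T - 2)).toFinset)
    have a2 := Finset.card_union_le (ed (T - 1)).toFinset (ed (T - 2)).toFinset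
    have := h2 (ed T)
    have := h2 (ed (T - 1))
    have := h2 (ed (T - 2))
    rw [hW]
    omega
  -- times of edges leaving `W`
  have htime : ∀ a b : Fin r × Fin (6 + Fintype.card α), a.1 ≠ b.1 → κ a ∉ W →
      ∃ i, i + 3 ≤ T ∧ ed i = s(κ a, κ b) := by
    intro a b hab haW
    obtain ⟨i, hi, h⟩ := hKadj a b hab
    have hiT : i ≤ T := hTmax i (Finset.mem_filter.2 ⟨Finset.mem_range.2 hi, a, b, hab, h⟩)
    have hmem : κ a ∈ (ed i).toFinset := by rw [Sym2.mem_toFinset, h]; exact Sym2.mem_mk_left _ _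
    refine ⟨i, ?_, h⟩
    by_contra hlt
    apply haW
    have : i = T ∨ i = T - 1 ∨ i = T - 2 := by omega
    rw [hW, Finset.mem_union, Finset.mem_union]
    rcases this with rfl | rfl | rfl
    · exact Or.inl hmem
    · exact Or.inr (Or.inl hmem)
    · exact Or.inr (Or.inr hmem)
  have hA : ∀ a b : Fin r × Fin (6 + Fintype.card α), a.1 ≠ b.1 → κ a ∉ W →
      (gProcSeq F H (T - 2)).Adj (κ a) (κ b) := by
    intro a b hab haW
    obtain ⟨i, hi, h⟩ := htime a b hab haW
    have h1 := hed i (by omega)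
    rw [h] at h1
    exact aux_mono F H (by omega : i + 1 ≤ T - 2) h1
  have hxW : κ x ∈ W := by
    rw [hW, Finset.mem_union, Sym2.mem_toFinset, hTxy]; exact Or.inl (Sym2.mem_mk_left _ _)
  have hyW : κ y ∈ W := by
    rw [hW, Finset.mem_union, Sym2.mem_toFinset, hTxy]; exact Or.inl (Sym2.mem_mk_right _ _)
  have hfin := aux_key F u v huv r _ c hc p q hpq hne (gProcSeq F H (T - 2)) κ
    κ.injective W (by omega) hA x y hxy hxW hyW
  -- `T` is at least `2`
  have hT2 : 2 ≤ T := by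
    obtain ⟨j, hj⟩ : ∃ j : Fin (6 + Fintype.card α), κ (x.1, j) ∉ W := by
      by_contra hall
      push Not at hall
      have hle : #(univ : Finset (Fin (6 + Fintype.card α))) ≤ #W :=
        Finset.card_le_card_of_injOn (fun j => κ (x.1, j)) (fun j _ => hall j)
          (fun j _ j' _ h => (Prod.ext_iff.1 (κ.injective h)).2)
      rw [Finset.card_univ, Fintype.card_fin] at hle
      have : 0 < Fintype.card α := Fintype.card_pos_iff.2 ⟨u⟩
      omega
    obtain ⟨i, hi, _⟩ := htime (x.1, j) y hxy hj
    omega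
  obtain ⟨m, rfl⟩ : ∃ m, T = m + 2 := ⟨T - 2, by omega⟩
  apply hed' _ hTτ
  rw [hTxy]
  exact hfin

/-- The case where `F` has a single edge. -/
theorem aux_single {α : Type*} [Fintype α] (F : SimpleGraph α) (u v : α) (huv : F.Adj u v)
    (hall : ∀ a b, F.Adj a b → s(a, b) = s(u, v)) (n : ℕ) (hn : Fintype.card α ≤ n)
    (H : SimpleGraph (Fin n)) : gRunTime F H ≤ 1 := by
  classical
  apply Nat.sInf_le
  have htop : gProcSeq F H 1 = ⊤ := by
    rw [eq_top_iff]
    intro x y hxy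
    have hxy : x ≠ y := hxy
    apply aux_step_adj hxy
    obtain ⟨φ⟩ : Nonempty (α ↪ Fin n) :=
      Function.Embedding.nonempty_of_card_le (by rw [Fintype.card_fin]; exact hn)
    set σ₁ := Equiv.swap (φ u) x
    set σ₂ := Equiv.swap (σ₁ (φ v)) y
    have h1 : σ₁ (φ u) = x := Equiv.swap_apply_left _ _
    have hu : σ₂ (σ₁ (φ u)) = x := by
      rw [h1]
      apply Equiv.swap_apply_of_ne_of_ne
      · rw [← h1]; exact fun h => huv.ne (φ.injective (σ₁.injective h))
      · exact hxy
    have hv : σ₂ (σ₁ (φ v)) = y := Equiv.swap_apply_left _ _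
    have hab' : ∀ a b, F.Adj a b → s(σ₂ (σ₁ (φ a)), σ₂ (σ₁ (φ b))) = s(x, y) := by
      intro a b hab
      rcases Sym2.eq_iff.1 (hall a b hab) with ⟨rfl, rfl⟩ | ⟨rfl, rfl⟩
      · rw [hu, hv]
      · rw [hu, hv, Sym2.eq_swap]
    refine ⟨φ.trans (σ₁.trans σ₂).toEmbedding, fun a b hab => Or.inr ⟨hab' a b hab, ?_⟩,
      u, v, huv, hab' u v huv⟩
    exact fun h => hab.ne (φ.injective (σ₁.injective (σ₂.injective h)))
  have h2 : gProcSeq F H 1 ≤ gProcSeq F H 2 := aux_mono F H (by omega)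
  have h3 : gProcSeq F H 2 = ⊤ := by rw [htop] at h2; exact eq_top_iff.2 h2
  show gProcSeq F H 1 = gProcSeq F H 2
  rw [htop, h3]

theorem aux_max {α : Type*} (F : SimpleGraph α) (n M : ℕ)
    (h : ∀ H : SimpleGraph (Fin n), gRunTime F H ≤ M) : gMaxRunTime F n ≤ M := by
  apply csSup_le
  · exact ⟨_, ⊥, rfl⟩
  · rintro t ⟨H, rfl⟩
    exact h H

/-- For every graph `F` with at least one edge, every `e ∈ E(F)`, and every `ε > 0`,
for all sufficiently large `n`,
`M_F(n) ≤ ((χ(F−e) − 2)/(χ(F−e) − 1) + ε) · C(n,2)`. -/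
theorem maxRunTime_le_chromatic {α : Type*} [Fintype α] (F : SimpleGraph α)
    (hF : F.edgeSet.Nonempty) (e : Sym2 α) (he : e ∈ F.edgeSet) (ε : ℝ) (hε : 0 < ε) :
    ∃ n₀ : ℕ, ∀ n : ℕ, n₀ ≤ n →
      (gMaxRunTime F n : ℝ) ≤
        ((((F.deleteEdges {e}).chromaticNumber.toNat : ℝ) - 2) /
            (((F.deleteEdges {e}).chromaticNumber.toNat : ℝ) - 1) + ε) * (n.choose 2 : ℝ) := by
  classical
  induction e with | _ u v
  have huv : F.Adj u v := he
  set k := (F.deleteEdges {s(u, v)}).chromaticNumber.toNat with hk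
  have hcol : (F.deleteEdges {s(u, v)}).Colorable k := by
    have h1 : (F.deleteEdges {s(u, v)}).Colorable (Fintype.card α) :=
      SimpleGraph.colorable_of_fintype _
    exact SimpleGraph.colorable_chromaticNumber h1
  obtain ⟨c⟩ := hcol
  have hc : ∀ a b, F.Adj a b → s(a, b) ≠ s(u, v) → c a ≠ c b := by
    intro a b hab hne
    apply c.valid
    rw [SimpleGraph.deleteEdges_adj]
    exact ⟨hab, hne⟩
  by_cases hall : ∀ a b, F.Adj a b → s(a, b) = s(u, v)
  · -- single edge
    have hk1 : k = 1 := by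
      have hle : (F.deleteEdges {s(u, v)}).chromaticNumber ≤ (1 : ℕ) := by
        apply SimpleGraph.Colorable.chromaticNumber_le
        refine ⟨SimpleGraph.Coloring.mk (fun _ => 0) ?_⟩
        intro a b hab
        rw [SimpleGraph.deleteEdges_adj] at hab
        exact absurd (hall a b hab.1) hab.2
      have h1 : k ≤ 1 := ENat.toNat_le_of_le_natCast hle
      have h2 : 0 < k := Fin.pos (c u)
      omega
    refine ⟨max (max (Fintype.card α) 2) (⌈2 / ε⌉₊ + 1), fun n hn => ?_⟩
    have h1 : gMaxRunTime F n ≤ 1 :=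
      aux_max F n 1 fun H => aux_single F u v huv hall n (by omega) H
    have h1' : (gMaxRunTime F n : ℝ) ≤ 1 := by exact_mod_cast h1
    have hn2 : (2 : ℝ) ≤ n := by exact_mod_cast (by omega : 2 ≤ n)
    have hn3 : 2 / ε + 1 ≤ n := by
      have h3 : ((⌈2 / ε⌉₊ + 1 : ℕ) : ℝ) ≤ n := by exact_mod_cast (by omega : ⌈2 / ε⌉₊ + 1 ≤ n)
      push_cast at h3
      linarith [Nat.le_ceil (2 / ε)]
    have h4 : 2 ≤ ε * (n - 1) := by
      have h5 : 2 / ε ≤ n - 1 := by linarith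
      rw [div_le_iff₀ hε] at h5
      linarith
    rw [hk1, Nat.cast_choose_two]
    norm_num
    nlinarith
  · push Not at hall
    obtain ⟨p, q, hpq, hne⟩ := hall
    have hk2 : 2 ≤ k := by
      have h1 := hc p q hpq hne
      by_contra hlt
      have h2 : k ≤ 1 := by omega
      apply h1
      apply Fin.ext
      have := (c p).2
      have := (c q).2
      omega
    obtain ⟨r, hr⟩ : ∃ r, k = r + 1 := ⟨k - 1, by omega⟩
    obtain ⟨n₀, hn₀⟩ := aux_erdos_stone r (6 + Fintype.card α) (by omega) ε hε
    refine ⟨n₀, fun n hn => ?_⟩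
    have h1 := aux_max F n _ fun H => aux_runtime F u v huv k c hc p q hpq hne n H
    have h2 : (gMaxRunTime F n : ℝ) ≤ _ := Nat.cast_le.2 h1
    refine h2.trans ?_
    rw [hr]
    refine (hn₀ n hn).trans (le_of_eq ?_)
    have hr0 : (r : ℝ) ≠ 0 := by
      have : r ≠ 0 := by omega
      exact_mod_cast this
    push_cast
    congr 2
    have hr1 : (r : ℝ) + 1 - 1 = r := by ring
    rw [hr1]
    field_simp
    ring
end

section
/- For all integers t ≥ 5, the maximum running time of the K_t-bootstrap percolation process satisfies M_{K_t}(n) ≤ (1 − 1/(t−2) + o(1))·C(n,2); in particular M_{K_5}(n) ≤ (2/3 + o(1))·C(n,2). -/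
open Finset Filter

lemma boot_step_adj {β : Type*} {r : ℕ} (P : SimpleGraph β) (x : β) (h : Fin r → β) (p0 : Fin r)
    (hx : ∀ p, p ≠ p0 → P.Adj x (h p)) (hh : ∀ p q, p ≠ q → P.Adj (h p) (h q))
    (hne : x ≠ h p0) :
    (gBootStep (⊤ : SimpleGraph (Fin (r + 1))) P).Adj x (h p0) := by
  unfold gBootStep
  rw [SimpleGraph.sup_adj, SimpleGraph.fromEdgeSet_adj]
  refine Or.inr ⟨?_, hne⟩
  have hxne : ∀ p, x ≠ h p := by
    intro p
    by_cases hp : p = p0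
    · subst hp; exact hne
    · exact (hx p hp).ne
  have hadj : ∀ p, (P ⊔ SimpleGraph.fromEdgeSet {s(x, h p0)}).Adj x (h p) := by
    intro p
    rw [SimpleGraph.sup_adj, SimpleGraph.fromEdgeSet_adj]
    by_cases hp : p = p0
    · subst hp; exact Or.inr ⟨rfl, hne⟩
    · exact Or.inl (hx p hp)
  refine ⟨⟨Fin.cons x h, ?_⟩, ?_, 0, p0.succ, ?_, ?_⟩
  · intro a b hab
    refine Fin.cases ?_ (fun p => ?_) a (motive := fun a => (Fin.cons x h : Fin (r+1) → β) a =
      (Fin.cons x h : Fin (r+1) → β) b → a = b) hab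
    · refine Fin.cases ?_ (fun q => ?_) b
      · intro _; rfl
      · intro h'; simp at h'; exact absurd h' (hxne q)
    · refine Fin.cases ?_ (fun q => ?_) b
      · intro h'; simp at h'; exact absurd h'.symm (hxne p)
      · intro h'
        simp at h'
        by_contra hc
        exact (hh p q (fun e => hc (by rw [e]))).ne h'
  · intro a b
    refine Fin.cases ?_ (fun p => ?_) a
    · refine Fin.cases ?_ (fun q => ?_) b
      · intro h'; exact absurd h' (by simp)
      · intro _; exact hadj q
    · refine Fin.cases ?_ (fun q => ?_) b
      · intro _; exact (hadj p).symm
      · intro h'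
        have : p ≠ q := by
          rintro rfl; exact absurd h' (by simp)
        exact Or.inl (hh p q this)
  · simp [SimpleGraph.top_adj, (Fin.succ_ne_zero p0).symm]
  · rfl

lemma gProcSeq_mono {α β : Type*} (F : SimpleGraph α) (H0 : SimpleGraph β) :
    Monotone (gProcSeq F H0) :=
  monotone_nat_of_le_succ (fun i => by
    change gProcSeq F H0 i ≤ gBootStep F (gProcSeq F H0 i)
    exact le_sup_left)

lemma pair_eq_of_not {γ : Type*} {a b u v : γ} (hne : a ≠ b)
    (hc : ¬ ((a ≠ u ∧ a ≠ v) ∨ (b ≠ u ∧ b ≠ v))) : (a = u ∧ b = v) ∨ (a = v ∧ b = u) := by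
  by_cases h1 : a = u <;> by_cases h2 : a = v <;> by_cases h3 : b = u <;>
    by_cases h4 : b = v <;> simp_all

/-- The key lemma: a graph made of edges born at pairwise distinct times contains no
complete `(t-1)`-partite graph with parts of size `5`. -/
lemma chain_free {β : Type*} (k : ℕ) (hk : 1 ≤ k) (H0 : SimpleGraph β) (G : SimpleGraph β)
    (e : ℕ → Sym2 β)
    (hG : ∀ x y, G.Adj x y → ∃ i, e i = s(x, y) ∧
      e i ∈ (gProcSeq (⊤ : SimpleGraph (Fin (k + 2))) H0 (i + 1)).edgeSet ∧
      e i ∉ (gProcSeq (⊤ : SimpleGraph (Fin (k + 2))) H0 i).edgeSet) :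
    (SimpleGraph.completeEquipartiteGraph (k + 1) 5).Free G := by
  rintro ⟨f⟩
  set P := gProcSeq (⊤ : SimpleGraph (Fin (k + 2))) H0 with hP
  have hmono : Monotone P := gProcSeq_mono _ _
  have finj : Function.Injective f := f.injective
  have key : ∀ a b : Fin (k + 1) × Fin 5, a.1 ≠ b.1 → ∃ i, e i = s(f a, f b) ∧
      e i ∈ (P (i + 1)).edgeSet ∧ e i ∉ (P i).edgeSet := by
    intro a b hab
    exact hG _ _ (f.toHom.map_adj (SimpleGraph.completeEquipartiteGraph_adj.mpr hab))
  have key' : ∀ a b : Fin (k + 1) × Fin 5, ∃ i, a.1 ≠ b.1 → e i = s(f a, f b) ∧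
      e i ∈ (P (i + 1)).edgeSet ∧ e i ∉ (P i).edgeSet := by
    intro a b
    by_cases hab : a.1 = b.1
    · exact ⟨0, fun h => absurd hab h⟩
    · obtain ⟨i, hi⟩ := key a b hab
      exact ⟨i, fun _ => hi⟩
  choose idx hidx using key'
  have idx_eq : ∀ a b c d, a.1 ≠ b.1 → c.1 ≠ d.1 → idx a b = idx c d →
      (a = c ∧ b = d) ∨ (a = d ∧ b = c) := by
    intro a b c d hab hcd h
    have h1 := (hidx a b hab).1
    have h2 := (hidx c d hcd).1
    rw [h, h2, Sym2.eq_iff] at h1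
    rcases h1 with ⟨h1, h2⟩ | ⟨h1, h2⟩
    · exact Or.inl ⟨(finj h1).symm, (finj h2).symm⟩
    · exact Or.inr ⟨(finj h2).symm, (finj h1).symm⟩
  obtain ⟨⟨u, v⟩, huv, hmax⟩ := Finset.exists_max_image
    (Finset.univ.filter (fun ab : (Fin (k + 1) × Fin 5) × (Fin (k + 1) × Fin 5) =>
      ab.1.1 ≠ ab.2.1)) (fun ab => idx ab.1 ab.2)
    ⟨((⟨0, by omega⟩, 0), (⟨1, by omega⟩, 0)), by simp⟩
  simp only [Finset.mem_filter, Finset.mem_univ, true_and] at huv hmax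
  set j := idx u v with hj
  have bad : ∀ d, 0 < d → ∃ x : Fin (k + 1) × Fin 5, ∀ a b, a.1 ≠ b.1 → idx a b + d = j →
      (a = x ∨ b = x) ∧ x ≠ u ∧ x ≠ v := by
    intro d hd
    by_cases h : ∃ a b : Fin (k + 1) × Fin 5, a.1 ≠ b.1 ∧ idx a b + d = j
    · obtain ⟨a, b, hab, h⟩ := h
      have : (a ≠ u ∧ a ≠ v) ∨ (b ≠ u ∧ b ≠ v) := by
        by_contra hc
        have habuv : (a = u ∧ b = v) ∨ (a = v ∧ b = u) := by
          have hne : a ≠ b := fun h => hab (by rw [h])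
          exact pair_eq_of_not hne hc
        rcases habuv with ⟨rfl, rfl⟩ | ⟨rfl, rfl⟩
        · omega
        · have h1 := (hidx a b hab)
          have h2 := (hidx b a hab.symm)
          have h3 : e (idx a b) = e (idx b a) := by rw [h1.1, h2.1, Sym2.eq_swap]
          apply h2.2.2
          rw [← h3]
          exact SimpleGraph.edgeSet_mono (hmono (by omega)) h1.2.1
      rcases this with hx | hx
      · refine ⟨a, fun a' b' hab' h' => ⟨?_, hx⟩⟩
        rcases idx_eq a' b' a b hab' hab (by omega) with h | h
        · exact Or.inl h.1
        · exact Or.inr h.2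
      · refine ⟨b, fun a' b' hab' h' => ⟨?_, hx⟩⟩
        rcases idx_eq a' b' a b hab' hab (by omega) with h | h
        · exact Or.inr h.2
        · exact Or.inl h.1
    · push Not at h
      exact ⟨u, fun a b hab h' => absurd h' (h a b hab)⟩
  obtain ⟨x1, hx1⟩ := bad 1 (by norm_num)
  obtain ⟨x2, hx2⟩ := bad 2 (by norm_num)
  obtain ⟨q, hq⟩ : ∃ q : Fin 5, q ∉ ({u.2, v.2, x1.2, x2.2} : Finset (Fin 5)) := by
    by_contra hc
    push Not at hc
    have h1 : (Finset.univ : Finset (Fin 5)) ⊆ {u.2, v.2, x1.2, x2.2} := fun q _ => hc q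
    have h2 := Finset.card_le_card h1
    have h3 : ({u.2, v.2, x1.2, x2.2} : Finset (Fin 5)).card ≤ 4 := Finset.card_le_four
    simp at h2
    omega
  simp only [Finset.mem_insert, Finset.mem_singleton, not_or] at hq
  obtain ⟨q1, q2, q3, q4⟩ := hq
  have wu : ∀ p : Fin (k + 1), (p, q) ≠ u := fun p h => q1 (by rw [← h])
  have wv : ∀ p : Fin (k + 1), (p, q) ≠ v := fun p h => q2 (by rw [← h])
  have wx1 : ∀ p : Fin (k + 1), (p, q) ≠ x1 := fun p h => q3 (by rw [← h])
  have wx2 : ∀ p : Fin (k + 1), (p, q) ≠ x2 := fun p h => q4 (by rw [← h])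
  -- edges between a `w` and any selected vertex come early
  have early : ∀ (a : Fin (k + 1) × Fin 5) (p : Fin (k + 1)), (a = u ∨ a = v ∨ a.2 = q) →
      a.1 ≠ p → idx a (p, q) + 3 ≤ j := by
    intro a p ha hap
    have h0 : idx a (p, q) ≤ j := hmax (a, (p, q)) hap
    have h1 : idx a (p, q) ≠ j := by
      intro h
      rcases idx_eq _ _ _ _ hap huv h with h | h
      · exact wv p h.2
      · exact wu p h.2
    have h2 : idx a (p, q) + 1 ≠ j := by
      intro h
      obtain ⟨h3, h4, h5⟩ := hx1 a (p, q) hap h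
      rcases h3 with h3 | h3
      · rcases ha with ha | ha | ha
        · exact h4 (h3.symm.trans ha)
        · exact h5 (h3.symm.trans ha)
        · exact q3 (by rw [← ha, h3])
      · exact wx1 p h3
    have h2 : idx a (p, q) + 2 ≠ j := by
      intro h
      obtain ⟨h3, h4, h5⟩ := hx2 a (p, q) hap h
      rcases h3 with h3 | h3
      · rcases ha with ha | ha | ha
        · exact h4 (h3.symm.trans ha)
        · exact h5 (h3.symm.trans ha)
        · exact q4 (by rw [← ha, h3])
      · exact wx2 p h3
    omega
  have hj3 : 3 ≤ j := le_trans (Nat.le_add_left _ _) (early u v.1 (Or.inl rfl) huv)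
  obtain ⟨m, hm⟩ : ∃ m, j = m + 2 := ⟨j - 2, by omega⟩
  have adjP : ∀ (a : Fin (k + 1) × Fin 5) (p : Fin (k + 1)), (a = u ∨ a = v ∨ a.2 = q) →
      a.1 ≠ p → (P m).Adj (f a) (f (p, q)) := by
    intro a p ha hap
    have h1 := early a p ha hap
    have h2 := hidx a (p, q) hap
    rw [← SimpleGraph.mem_edgeSet, ← h2.1]
    exact SimpleGraph.edgeSet_mono (hmono (by omega)) h2.2.1
  have step1 : (P (m + 1)).Adj (f u) (f (u.1, q)) := by
    refine boot_step_adj (P m) (f u) (fun p => f (p, q)) u.1 ?_ ?_ ?_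
    · intro p hp
      exact adjP u p (Or.inl rfl) hp.symm
    · intro p p' hp
      exact adjP (p, q) p' (Or.inr (Or.inr rfl)) hp
    · exact fun h => wu _ (finj h).symm
  have step2 : (P (m + 2)).Adj (f u) (f v) := by
    have hle : P m ≤ P (m + 1) := hmono (Nat.le_succ m)
    have := boot_step_adj (P (m + 1)) (f u) (fun p => if p = v.1 then f v else f (p, q)) v.1
      ?_ ?_ ?_
    · simp only [if_true] at this
      exact this
    · intro p hp
      simp only [hp, if_false]
      by_cases hpu : u.1 = p
      · rw [← hpu]; exact step1
      · exact hle (adjP u p (Or.inl rfl) hpu)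
    · intro p p' hp
      by_cases h1 : p = v.1
      · have h2 : p' ≠ v.1 := fun h => hp (h1.trans h.symm)
        simp only [h1, h2, if_true, if_false]
        exact hle (adjP v p' (Or.inr (Or.inl rfl)) h2.symm)
      · by_cases h2 : p' = v.1
        · simp only [h1, h2, if_true, if_false]
          exact (hle (adjP v p (Or.inr (Or.inl rfl)) (Ne.symm h1))).symm
        · simp only [h1, h2, if_false]
          exact hle (adjP (p, q) p' (Or.inr (Or.inr rfl)) hp)
    · simp only [if_true]
      exact fun h => huv (by rw [finj h])
  have hlast := hidx u v huv
  apply hlast.2.2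
  rw [hlast.1, SimpleGraph.mem_edgeSet, ← hj, hm]
  exact step2

/-- The running time is at most the extremal number of the complete equipartite graph. -/
lemma gRunTime_le (k : ℕ) (hk : 1 ≤ k) (n : ℕ) (H0 : SimpleGraph (Fin n)) :
    gRunTime (⊤ : SimpleGraph (Fin (k + 2))) H0 ≤
      SimpleGraph.extremalNumber n (SimpleGraph.completeEquipartiteGraph (k + 1) 5) := by
  classical
  set P := gProcSeq (⊤ : SimpleGraph (Fin (k + 2))) H0 with hP
  set T := gRunTime (⊤ : SimpleGraph (Fin (k + 2))) H0 with hT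
  have hmono : Monotone P := gProcSeq_mono _ _
  rcases Nat.eq_zero_or_pos T with h0 | hpos
  · rw [h0]; exact Nat.zero_le _
  have hex : ∀ i, i < T → ∃ e, e ∈ (P (i + 1)).edgeSet ∧ e ∉ (P i).edgeSet := by
    intro i hi
    have hne : P i ≠ P (i + 1) := Nat.notMem_of_lt_sInf hi
    by_contra hc
    push Not at hc
    apply hne
    exact le_antisymm (hmono (Nat.le_succ i)) (SimpleGraph.edgeSet_subset_edgeSet.mp hc)
  obtain ⟨e0, -⟩ := hex 0 hpos
  have hex' : ∀ i, ∃ e, i < T → e ∈ (P (i + 1)).edgeSet ∧ e ∉ (P i).edgeSet := by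
    intro i
    by_cases hi : i < T
    · obtain ⟨e, he⟩ := hex i hi
      exact ⟨e, fun _ => he⟩
    · exact ⟨e0, fun h => absurd h hi⟩
  choose e he using hex'
  have hinj : Set.InjOn e (Finset.range T) := by
    have : ∀ i i', i < i' → i' < T → e i ≠ e i' := by
      intro i i' h h' heq
      apply (he i' h').2
      rw [← heq]
      exact SimpleGraph.edgeSet_mono (hmono h) (he i (h.trans h')).1
    intro i hi i' hi' heq
    simp at hi hi'
    rcases lt_trichotomy i i' with h | h | h
    · exact absurd heq (this i i' h hi')
    · exact h
    · exact absurd heq.symm (this i' i h hi)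
  set S : Finset (Sym2 (Fin n)) := (Finset.range T).image e with hS
  set G : SimpleGraph (Fin n) := SimpleGraph.fromEdgeSet (S : Set (Sym2 (Fin n))) with hGdef
  have hSc : S.card = T := by
    rw [hS, Finset.card_image_of_injOn hinj, Finset.card_range]
  have hsub : S ⊆ G.edgeFinset := by
    intro x hx
    rw [SimpleGraph.mem_edgeFinset, hGdef, SimpleGraph.edgeSet_fromEdgeSet]
    refine ⟨hx, ?_⟩
    obtain ⟨i, hi, rfl⟩ := Finset.mem_image.mp hx
    exact SimpleGraph.not_isDiag_of_mem_edgeSet _ (he i (Finset.mem_range.mp hi)).1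
  have hfree : (SimpleGraph.completeEquipartiteGraph (k + 1) 5).Free G := by
    refine chain_free k hk H0 G e ?_
    intro x y hxy
    have h1 := (SimpleGraph.fromEdgeSet_adj _).mp hxy
    obtain ⟨i, hi, hi'⟩ := Finset.mem_image.mp (Finset.mem_coe.mp h1.1)
    exact ⟨i, hi', he i (Finset.mem_range.mp hi)⟩
  have := SimpleGraph.card_edgeFinset_le_extremalNumber hfree
  rw [Fintype.card_fin] at this
  calc T = S.card := hSc.symm
    _ ≤ _ := Finset.card_le_card hsub
    _ ≤ _ := by convert this

/-- Erdős–Stone, edge version, from the minimum degree version. -/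
lemma extremal_bound (r s : ℕ) (hr : 1 ≤ r) (ε : ℝ) (hε : 0 < ε) :
    ∃ (N : ℕ) (C : ℝ), ∀ n, N ≤ n →
      (SimpleGraph.extremalNumber n (SimpleGraph.completeEquipartiteGraph (r + 1) s) : ℝ) ≤
        C + (1 - 1 / (r : ℝ) + ε) * (n * (n + 1) / 2) := by
  classical
  obtain ⟨N, hN⟩ := eventually_atTop.mp
    (SimpleGraph.eventually_completeEquipartiteGraph_isContained_of_minDegree hε r s)
  set c : ℝ := 1 - 1 / (r : ℝ) + ε with hc
  have hr' : (1 : ℝ) ≤ r := by exact_mod_cast hr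
  have hc0 : 0 ≤ c := by
    have : 1 / (r : ℝ) ≤ 1 := by
      rw [div_le_one (by linarith)]; exact hr'
    linarith
  refine ⟨N, SimpleGraph.extremalNumber N (SimpleGraph.completeEquipartiteGraph (r + 1) s), ?_⟩
  intro n hn
  induction n, hn using Nat.le_induction with
  | base =>
    have : 0 ≤ c * ((N : ℝ) * (N + 1) / 2) := by positivity
    linarith
  | succ n hn ih =>
    have hR : (0 : ℝ) ≤ (SimpleGraph.extremalNumber N (SimpleGraph.completeEquipartiteGraph (r + 1) s) : ℝ)
        + c * (((n + 1 : ℕ) : ℝ) * ((n + 1 : ℕ) + 1) / 2) := by positivity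
    have hiff := SimpleGraph.extremalNumber_le_iff_of_nonneg (V := Fin (n + 1))
      (SimpleGraph.completeEquipartiteGraph (r + 1) s) hR
    rw [Fintype.card_fin] at hiff
    rw [hiff]
    intro G _ hfree
    have hdeg : (G.minDegree : ℝ) < c * ((n + 1 : ℕ) : ℝ) := by
      by_contra hcon
      push Not at hcon
      exact hfree (hN (n + 1) (by omega) hcon)
    obtain ⟨x, hx⟩ := G.exists_minimal_degree_vertex
    have h1 := SimpleGraph.card_edgeFinset_deleteIncidenceSet_le_extremalNumber hfree x
    rw [Fintype.card_fin, Nat.add_sub_cancel] at h1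
    have h2 := G.card_edgeFinset_deleteIncidenceSet x
    have h3 : G.edgeFinset.card ≤ (G.deleteIncidenceSet x).edgeFinset.card + G.degree x := by
      omega
    have h4 : (G.edgeFinset.card : ℝ) ≤
        (SimpleGraph.extremalNumber n (SimpleGraph.completeEquipartiteGraph (r + 1) s) : ℝ)
          + G.minDegree := by
      rw [hx]; exact_mod_cast h3.trans (Nat.add_le_add_right h1 _)
    push_cast at hdeg ⊢
    nlinarith

lemma gMaxRunTime_bound (k : ℕ) (hk : 1 ≤ k) (ε : ℝ) (hε : 0 < ε) :
    ∃ n₀ : ℕ, ∀ n : ℕ, n₀ ≤ n →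
      (gMaxRunTime (⊤ : SimpleGraph (Fin (k + 2))) n : ℝ) ≤
          (1 - 1 / (k : ℝ) + ε) * (n.choose 2 : ℝ) := by
  obtain ⟨N, C, hC⟩ := extremal_bound k 5 hk (ε / 2) (by linarith)
  set c : ℝ := 1 - 1 / (k : ℝ) + ε / 2 with hc
  obtain ⟨M, hM⟩ := exists_nat_ge (max C (1 + 4 * (c + 1) / ε))
  refine ⟨max N M, fun n hn => ?_⟩
  have hnN : N ≤ n := le_trans (le_max_left _ _) hn
  have hnM : (M : ℝ) ≤ n := by exact_mod_cast le_trans (le_max_right _ _) hn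
  have h1 : gMaxRunTime (⊤ : SimpleGraph (Fin (k + 2))) n ≤
      SimpleGraph.extremalNumber n (SimpleGraph.completeEquipartiteGraph (k + 1) 5) := by
    apply csSup_le'
    rintro t ⟨H0, rfl⟩
    exact gRunTime_le k hk n H0
  have h2 : (gMaxRunTime (⊤ : SimpleGraph (Fin (k + 2))) n : ℝ) ≤
      C + c * (n * (n + 1) / 2) := le_trans (by exact_mod_cast h1) (hC n hnN)
  refine h2.trans ?_
  rw [Nat.cast_choose_two]
  have h3 : C ≤ n := (le_max_left _ _).trans (hM.trans hnM)
  have h4 : 1 + 4 * (c + 1) / ε ≤ n := (le_max_right _ _).trans (hM.trans hnM)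
  have h5 : 4 * (c + 1) ≤ ε * (n - 1) := by
    have : 4 * (c + 1) / ε ≤ n - 1 := by linarith
    rw [div_le_iff₀ hε] at this
    linarith
  have h6 : (0 : ℝ) ≤ n := Nat.cast_nonneg n
  have h7 : 1 - 1 / (k : ℝ) + ε = c + ε / 2 := by rw [hc]; ring
  rw [h7]
  nlinarith [mul_le_mul_of_nonneg_left h5 h6]

/-- For all `t ≥ 5`, `M_{K_t}(n) ≤ (1 − 1/(t−2) + o(1)) · C(n,2)`; in particular
`M_{K_5}(n) ≤ (2/3 + o(1)) · C(n,2)`. -/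
theorem maxRunTime_clique_ge_five (t : ℕ) (ht : 5 ≤ t) (ε : ℝ) (hε : 0 < ε) :
    ∃ n₀ : ℕ, ∀ n : ℕ, n₀ ≤ n →
      (gMaxRunTime (⊤ : SimpleGraph (Fin t)) n : ℝ) ≤
          (1 - 1 / ((t : ℝ) - 2) + ε) * (n.choose 2 : ℝ) ∧
        (gMaxRunTime (⊤ : SimpleGraph (Fin 5)) n : ℝ) ≤ (2 / 3 + ε) * (n.choose 2 : ℝ) := by
  obtain ⟨k, rfl⟩ : ∃ k, t = k + 2 := ⟨t - 2, by omega⟩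
  obtain ⟨n1, h1⟩ := gMaxRunTime_bound k (by omega) ε hε
  obtain ⟨n2, h2⟩ := gMaxRunTime_bound 3 (by omega) ε hε
  refine ⟨max n1 n2, fun n hn => ⟨?_, ?_⟩⟩
  · have := h1 n (le_trans (le_max_left _ _) hn)
    have h3 : ((k + 2 : ℕ) : ℝ) - 2 = k := by push_cast; ring
    rw [h3]
    exact this
  · have := h2 n (le_trans (le_max_right _ _) hn)
    have h3 : (1 : ℝ) - 1 / ((3 : ℕ) : ℝ) = 2 / 3 := by norm_num
    rw [h3] at this
    exact this
end
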